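/- Let L : ℝⁿ × ℝᵐ → ℝ be twice continuously differentiable and ρ-weakly convex–weakly concave, let η > max(ρ, 0), and suppose L is α-interaction dominant in both x and y for some α ∈ ℝ. Then for every z ∈ ℝⁿ × ℝᵐ, the proximal step z₊ = prox_η(z) satisfies ℒ(z₊) ≤ ℒ(z) − (1/2)(α − ηρ/(η−ρ))·‖z₊ − z‖², where ℒ(x,y) = −e_η{−L(x,·)}(y) − e_η{L(·,y)}(x). -/

import Mathlib

open Filter Topology Metric
open scoped RealInnerProductSpace

noncomputable section

abbrev Eu (n : ℕ) : Type := EuclideanSpace ℝ (Fin n)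

noncomputable def gradx {n m : ℕ} (L : Eu n × Eu m → ℝ) (z : Eu n × Eu m) : Eu n :=
  gradient (fun u => L (u, z.2)) z.1

noncomputable def grady {n m : ℕ} (L : Eu n × Eu m → ℝ) (z : Eu n × Eu m) : Eu m :=
  gradient (fun v => L (z.1, v)) z.2

noncomputable def Hxx {n m : ℕ} (L : Eu n × Eu m → ℝ) (z : Eu n × Eu m) : Eu n →L[ℝ] Eu n :=
  fderiv ℝ (fun x => gradient (fun u => L (u, z.2)) x) z.1

noncomputable def Hxy {n m : ℕ} (L : Eu n × Eu m → ℝ) (z : Eu n × Eu m) : Eu m →L[ℝ] Eu n :=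
  fderiv ℝ (fun y => gradient (fun u => L (u, y)) z.1) z.2

noncomputable def Hyx {n m : ℕ} (L : Eu n × Eu m → ℝ) (z : Eu n × Eu m) : Eu n →L[ℝ] Eu m :=
  fderiv ℝ (fun x => gradient (fun v => L (x, v)) z.2) z.1

noncomputable def Hyy {n m : ℕ} (L : Eu n × Eu m → ℝ) (z : Eu n × Eu m) : Eu m →L[ℝ] Eu m :=
  fderiv ℝ (fun y => gradient (fun v => L (z.1, v)) y) z.2

def WeaklyConvexConcave {n m : ℕ} (ρ : ℝ) (L : Eu n × Eu m → ℝ) : Prop :=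
  ∀ z : Eu n × Eu m,
    (∀ v : Eu n, -ρ * ‖v‖ ^ 2 ≤ ⟪(Hxx L z) v, v⟫) ∧
    (∀ w : Eu m, ⟪(Hyy L z) w, w⟫ ≤ ρ * ‖w‖ ^ 2)

def IntDomX {n m : ℕ} (η α : ℝ) (L : Eu n × Eu m → ℝ) : Prop :=
  ∀ z : Eu n × Eu m, ∀ v : Eu n,
    α * ‖v‖ ^ 2 ≤
      ⟪(Hxx L z) v +
        (Hxy L z) ((Ring.inverse (η • (1 : Eu m →L[ℝ] Eu m) - Hyy L z)) ((Hyx L z) v)), v⟫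

def IntDomY {n m : ℕ} (η α : ℝ) (L : Eu n × Eu m → ℝ) : Prop :=
  ∀ z : Eu n × Eu m, ∀ w : Eu m,
    α * ‖w‖ ^ 2 ≤
      ⟪-((Hyy L z) w) +
        (Hyx L z) ((Ring.inverse (η • (1 : Eu n →L[ℝ] Eu n) + Hxx L z)) ((Hxy L z) w)), w⟫

noncomputable def proxObj {n m : ℕ} (η : ℝ) (L : Eu n × Eu m → ℝ) (z w : Eu n × Eu m) : ℝ :=
  L w + η / 2 * ‖w.1 - z.1‖ ^ 2 - η / 2 * ‖w.2 - z.2‖ ^ 2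

def IsProxPoint {n m : ℕ} (η : ℝ) (L : Eu n × Eu m → ℝ) (z w : Eu n × Eu m) : Prop :=
  (∀ v : Eu m, proxObj η L z (w.1, v) ≤ proxObj η L z w) ∧
  (∀ u : Eu n, proxObj η L z w ≤ proxObj η L z (u, w.2))

noncomputable def saddleEnv {n m : ℕ} (η : ℝ) (L : Eu n × Eu m → ℝ)
    (prox : Eu n × Eu m → Eu n × Eu m) (z : Eu n × Eu m) : ℝ :=
  proxObj η L z (prox z)

noncomputable def moreau {n : ℕ} (η : ℝ) (f : Eu n → ℝ) (x : Eu n) : ℝ :=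
  ⨅ u : Eu n, (f u + η / 2 * ‖u - x‖ ^ 2)

noncomputable def lyap {n m : ℕ} (η : ℝ) (L : Eu n × Eu m → ℝ) (z : Eu n × Eu m) : ℝ :=
  -(moreau η (fun v => -L (z.1, v)) z.2) - moreau η (fun u => L (u, z.2)) z.1

noncomputable def hessForm {n m : ℕ} (L : Eu n × Eu m → ℝ) (z v w : Eu n × Eu m) : ℝ :=
  ⟪(Hxx L z) v.1, w.1⟫ + ⟪(Hxy L z) v.2, w.1⟫ + ⟪(Hyx L z) v.1, w.2⟫ + ⟪(Hyy L z) v.2, w.2⟫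

/-- A point with vanishing first and positive second derivative is a strict local minimum from
the right. -/
theorem eventually_lt_of_deriv_deriv_pos {k k' : ℝ → ℝ} {c x₀ : ℝ}
    (hk : ∀ s, HasDerivAt k (k' s) s) (hk' : HasDerivAt k' c x₀) (h0 : k' x₀ = 0) (hc : 0 < c) :
    ∀ᶠ s in 𝓝[>] x₀, k x₀ < k s := by
  have hd : deriv k = k' := funext fun s => (hk s).deriv
  have hsign := eventually_nhdsWithin_sign_eq_of_deriv_pos (hk'.deriv.symm ▸ hc) h0
  have hpos : ∀ᶠ s in 𝓝[>] x₀, 0 < k' s := by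
    rw [← hd]
    exact deriv_pos_right_of_sign_deriv (nhdsWithin_le_nhds (hd.symm ▸ hsign))
  obtain ⟨b, hb, hpos⟩ := (nhdsGT_basis x₀).eventually_iff.mp hpos
  refine (nhdsGT_basis x₀).eventually_iff.mpr ⟨b, hb, fun s hs => ?_⟩
  have hmono : StrictMonoOn k (Set.Icc x₀ s) := by
    refine strictMonoOn_of_deriv_pos (convex_Icc _ _)
      (fun u _ => (hk u).continuousAt.continuousWithinAt) fun u hu => ?_
    rw [interior_Icc] at hu
    rw [hd]
    exact hpos ⟨hu.1, hu.2.trans hs.2⟩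
  exact hmono (Set.left_mem_Icc.2 hs.1.le) (Set.right_mem_Icc.2 hs.1.le) hs.1

theorem le_add_half_of_deriv_deriv_le {k k' k'' : ℝ → ℝ} {c : ℝ}
    (hk : ∀ s, HasDerivAt k (k' s) s) (hk' : ∀ s, HasDerivAt k' (k'' s) s) (hc : ∀ s, k'' s ≤ c) :
    k 1 ≤ k 0 + k' 0 + c / 2 := by
  have hd1 : ∀ s, HasDerivAt (fun s => k' s - c * s) (k'' s - c) s := fun s => by
    exact ((hk' s).sub ((hasDerivAt_id s).const_mul c)).congr_deriv (by ring)
  have h1 : Antitone fun s => k' s - c * s :=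
    antitone_of_deriv_nonpos (fun s => (hd1 s).differentiableAt)
      fun s => by rw [(hd1 s).deriv]; linarith [hc s]
  have hd2 : ∀ s, HasDerivAt (fun s => k s - k' 0 * s - c / 2 * s ^ 2) (k' s - k' 0 - c * s) s :=
    fun s => by
      refine (((hk s).sub ((hasDerivAt_id s).const_mul (k' 0))).sub
        (((hasDerivAt_id s).pow 2).const_mul (c / 2))).congr_deriv ?_
      simp only [id]
      push_cast
      ring
  have h2 : AntitoneOn (fun s => k s - k' 0 * s - c / 2 * s ^ 2) (Set.Icc 0 1) := by
    refine antitoneOn_of_deriv_nonpos (convex_Icc _ _)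
      (fun u _ => (hd2 u).continuousAt.continuousWithinAt)
      (fun u _ => (hd2 u).differentiableAt.differentiableWithinAt) fun u hu => ?_
    rw [interior_Icc] at hu
    have := h1 hu.1.le
    simp only at this
    rw [(hd2 u).deriv]
    linarith
  have := h2 (Set.left_mem_Icc.2 zero_le_one) (Set.right_mem_Icc.2 zero_le_one) zero_le_one
  simp only at this
  linarith

section Line

variable {G : Type*} [NormedAddCommGroup G] [NormedSpace ℝ G] {f : G → ℝ}

theorem hasDerivAt_comp_line (hf : ContDiff ℝ 2 f) (z ξ : G) (s : ℝ) :
    HasDerivAt (fun s : ℝ => f (z + s • ξ)) (fderiv ℝ f (z + s • ξ) ξ) s := by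
  have hline : HasDerivAt (fun s : ℝ => z + s • ξ) ξ s := by
    simpa using ((hasDerivAt_id s).smul_const ξ).const_add z
  exact (hf.differentiable (by norm_num) _).hasFDerivAt.comp_hasDerivAt s hline

theorem hasDerivAt_fderiv_comp_line (hf : ContDiff ℝ 2 f) (z ξ : G) (s : ℝ) :
    HasDerivAt (fun s : ℝ => fderiv ℝ f (z + s • ξ) ξ)
      (fderiv ℝ (fderiv ℝ f) (z + s • ξ) ξ ξ) s := by
  have hline : HasDerivAt (fun s : ℝ => z + s • ξ) ξ s := by
    simpa using ((hasDerivAt_id s).smul_const ξ).const_add z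
  have hf' : ContDiff ℝ 1 (fderiv ℝ f) := hf.fderiv_right (by norm_num)
  have := (hf'.differentiable (by norm_num) _).hasFDerivAt.comp_hasDerivAt s hline
  simpa using this.clm_apply (hasDerivAt_const s ξ)

theorem le_quadratic_of_hessian_le (hf : ContDiff ℝ 2 f) (z ξ : G) {c : ℝ}
    (hc : ∀ s : ℝ, fderiv ℝ (fderiv ℝ f) (z + s • ξ) ξ ξ ≤ c) :
    f (z + ξ) ≤ f z + fderiv ℝ f z ξ + c / 2 := by
  simpa using le_add_half_of_deriv_deriv_le (hasDerivAt_comp_line hf z ξ)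
    (hasDerivAt_fderiv_comp_line hf z ξ) hc

end Line

/-- A function on `ℝ × F` which is continuous and, uniformly for `t ∈ [0, 1]`, dominated by a
coercive concave quadratic in the second variable attains its maximum over `[0, 1] × F`. -/
theorem exists_forall_le_of_quadratic_bound {F : Type*} [NormedAddCommGroup F] [ProperSpace F]
    {K : ℝ × F → ℝ} (hK : Continuous K) {a A κ : ℝ} (ha : 0 ≤ a) (hκ : 0 < κ) (y : F)
    (hbound : ∀ t ∈ Set.Icc (0 : ℝ) 1, ∀ v, K (t, v) ≤ a + A * ‖v - y‖ - κ * ‖v - y‖ ^ 2) :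
    ∃ t ∈ Set.Icc (0 : ℝ) 1, ∃ v, ∀ s ∈ Set.Icc (0 : ℝ) 1, ∀ u, K (s, u) ≤ K (t, v) := by
  set b := a + A + |K (0, y)| with hb
  set R := max 1 (b / κ)
  have hmem : ((0 : ℝ), y) ∈ Set.Icc (0 : ℝ) 1 ×ˢ closedBall y R :=
    ⟨Set.left_mem_Icc.2 zero_le_one, mem_closedBall_self (zero_le_one.trans (le_max_left _ _))⟩
  obtain ⟨⟨t, v⟩, ⟨ht, -⟩, hmax⟩ := (isCompact_Icc.prod (isCompact_closedBall y R)).exists_isMaxOn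
    ⟨_, hmem⟩ hK.continuousOn
  refine ⟨t, ht, v, fun s hs u => ?_⟩
  by_cases hu : u ∈ closedBall y R
  · exact hmax (Set.mk_mem_prod hs hu)
  · rw [mem_closedBall, dist_eq_norm, not_le] at hu
    refine le_trans ?_ (hmax hmem)
    have h1 : 1 < ‖u - y‖ := (le_max_left _ _).trans_lt hu
    have h2 : b < κ * ‖u - y‖ := by
      have := (le_max_right 1 (b / κ)).trans_lt hu
      rwa [div_lt_iff₀' hκ] at this
    have h3 := hbound s hs u
    have h4 := neg_abs_le (K (0, y))
    have h5 := abs_nonneg (K (0, y))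
    nlinarith

section Partial

variable {E F : Type*} [NormedAddCommGroup E] [NormedSpace ℝ E]
  [NormedAddCommGroup F] [NormedSpace ℝ F] {L : E × F → ℝ}

theorem fderiv_partial_left (hL : Differentiable ℝ L) (x : E) (y : F) (v : E) :
    fderiv ℝ (fun u => L (u, y)) x v = fderiv ℝ L (x, y) (v, 0) := by
  have h : HasFDerivAt (fun u => L (u, y)) _ x :=
    (hL (x, y)).hasFDerivAt.comp x (hasFDerivAt_prodMk_left x y)
  simp [h.fderiv]

theorem fderiv_partial_right (hL : Differentiable ℝ L) (x : E) (y : F) (w : F) :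
    fderiv ℝ (fun v => L (x, v)) y w = fderiv ℝ L (x, y) (0, w) := by
  have h : HasFDerivAt (fun v => L (x, v)) _ y :=
    (hL (x, y)).hasFDerivAt.comp y (hasFDerivAt_prodMk_right x y)
  simp [h.fderiv]

end Partial

section SaddleCore

variable {E F : Type*} [NormedAddCommGroup E] [NormedSpace ℝ E]
  [NormedAddCommGroup F] [InnerProductSpace ℝ F]

theorem hasDerivAt_half_norm_sq_line (η : ℝ) (a w : F) (s : ℝ) :
    HasDerivAt (fun s : ℝ => η / 2 * ‖a + s • w‖ ^ 2) (η * ⟪a + s • w, w⟫) s := by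
  have hline : HasDerivAt (fun s : ℝ => a + s • w) w s := by
    simpa using ((hasDerivAt_id s).smul_const w).const_add a
  refine (hline.norm_sq.const_mul (η / 2)).congr_deriv ?_
  ring

theorem hasDerivAt_inner_line (η : ℝ) (a w : F) (s : ℝ) :
    HasDerivAt (fun s : ℝ => η * ⟪a + s • w, w⟫) (η * ‖w‖ ^ 2) s := by
  have hline : HasDerivAt (fun s : ℝ => a + s • w) w s := by
    simpa using ((hasDerivAt_id s).smul_const w).const_add a
  refine ((hline.inner ℝ (hasDerivAt_const s w)).const_mul η).congr_deriv ?_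
  simp

/-- First-order optimality for a proximal maximization. -/
theorem fderiv_eq_of_prox_max {f : F → ℝ} (hf : Differentiable ℝ f) {η : ℝ} {y y₀ : F}
    (hmax : ∀ v, f v - η / 2 * ‖v - y‖ ^ 2 ≤ f y₀ - η / 2 * ‖y₀ - y‖ ^ 2) (w : F) :
    fderiv ℝ f y₀ w = η * ⟪y₀ - y, w⟫ := by
  have hline : HasDerivAt (fun s : ℝ => y₀ + s • w) w 0 := by
    simpa using ((hasDerivAt_id (0 : ℝ)).smul_const w).const_add y₀
  have h1 : HasDerivAt (fun s : ℝ => f (y₀ + s • w)) (fderiv ℝ f y₀ w) 0 := by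
    have : HasDerivAt (fun s : ℝ => f (y₀ + s • w)) (fderiv ℝ f (y₀ + (0 : ℝ) • w) w) 0 :=
      (hf _).hasFDerivAt.comp_hasDerivAt 0 hline
    simpa using this
  have h2 := h1.sub (hasDerivAt_half_norm_sq_line η (y₀ - y) w 0)
  have hm : IsLocalMax
      ((fun s : ℝ => f (y₀ + s • w)) - fun s : ℝ => η / 2 * ‖y₀ - y + s • w‖ ^ 2) 0 := by
    refine Filter.Eventually.of_forall fun s => ?_
    have := hmax (y₀ + s • w)
    simpa [sub_add_eq_add_sub] using this
  have := hm.hasDerivAt_eq_zero h2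
  simp only [zero_smul, add_zero] at this
  linarith

theorem exists_lt_prox_max [ProperSpace F] {L : E × F → ℝ} (hL : ContDiff ℝ 2 L) {ρ η α β : ℝ}
    (hρη : ρ < η)
    (hconc : ∀ z (w : F), fderiv ℝ (fderiv ℝ L) z (0, w) (0, w) ≤ ρ * ‖w‖ ^ 2)
    (hcurv : ∀ z (d : E), ∃ w : F,
      α * ‖d‖ ^ 2 ≤ fderiv ℝ (fderiv ℝ L) z (d, w) (d, w) - η * ‖w‖ ^ 2)
    {x₀ : E} {y₀ y : F}
    (hmax : ∀ v, L (x₀, v) - η / 2 * ‖v - y‖ ^ 2 ≤ L (x₀, y₀) - η / 2 * ‖y₀ - y‖ ^ 2)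
    {d : E} (hd : d ≠ 0) (hβ : β < α) :
    ∃ v, L (x₀, y₀) - η / 2 * ‖y₀ - y‖ ^ 2 + fderiv ℝ L (x₀, y₀) (d, 0) + β / 2 * ‖d‖ ^ 2 <
      L (x₀ + d, v) - η / 2 * ‖v - y‖ ^ 2 := by
  by_contra! hcon
  have hLc := hL.continuous
  have hdiff : Differentiable ℝ L := hL.differentiable (by norm_num)
  set p := fderiv ℝ L (x₀, y₀) (d, 0) with hp
  set q := β * ‖d‖ ^ 2
  let K : ℝ × F → ℝ := fun τ =>
    L (x₀ + τ.1 • d, τ.2) - η / 2 * ‖τ.2 - y‖ ^ 2 - p * τ.1 - q / 2 * τ.1 ^ 2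
  have hKc : Continuous K := by fun_prop
  have hderiv : ∀ t v w s, HasDerivAt (fun s : ℝ => K (t + s, v + s • w))
      (fderiv ℝ L ((x₀ + t • d, v) + s • (d, w)) (d, w) - η * ⟪v - y + s • w, w⟫ - p
        - q * (t + s)) s := by
    intro t v w s
    have h1 := hasDerivAt_comp_line hL (x₀ + t • d, v) (d, w) s
    have h2 := hasDerivAt_half_norm_sq_line η (v - y) w s
    have h3 : HasDerivAt (fun s : ℝ => p * (t + s)) p s := by
      simpa using ((hasDerivAt_id s).const_add t).const_mul p
    have h4 : HasDerivAt (fun s : ℝ => q / 2 * (t + s) ^ 2) (q * (t + s)) s := by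
      refine ((((hasDerivAt_id s).const_add t).pow 2).const_mul (q / 2)).congr_deriv ?_
      simp only [id]
      push_cast
      ring
    refine (((h1.sub h2).sub h3).sub h4).congr_of_eventuallyEq (.of_forall fun u => ?_)
    simp [K, add_smul, add_assoc, sub_add_eq_add_sub]
  have hderiv2 : ∀ t v w, HasDerivAt (fun s : ℝ =>
      fderiv ℝ L ((x₀ + t • d, v) + s • (d, w)) (d, w) - η * ⟪v - y + s • w, w⟫ - p - q * (t + s))
      (fderiv ℝ (fderiv ℝ L) (x₀ + t • d, v) (d, w) (d, w) - η * ‖w‖ ^ 2 - q) 0 := by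
    intro t v w
    have h1 := hasDerivAt_fderiv_comp_line hL (x₀ + t • d, v) (d, w) 0
    have h2 := hasDerivAt_inner_line η (v - y) w 0
    have h4 : HasDerivAt (fun s : ℝ => q * (t + s)) q 0 := by
      simpa using ((hasDerivAt_id (0 : ℝ)).const_add t).const_mul q
    refine (((h1.sub h2).sub_const p).sub h4).congr_deriv ?_
    simp
  -- Along a suitable direction, `K` strictly increases from each of its critical points.
  have hinc : ∀ t v, ∃ w,
      (fderiv ℝ L (x₀ + t • d, v) (d, w) - η * ⟪v - y, w⟫ - p - q * t = 0) →
      ∀ᶠ s in 𝓝[>] (0 : ℝ), K (t, v) < K (t + s, v + s • w) := by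
    intro t v
    obtain ⟨w, hw⟩ := hcurv (x₀ + t • d, v) d
    refine ⟨w, fun h0 => ?_⟩
    have hpos : 0 < fderiv ℝ (fderiv ℝ L) (x₀ + t • d, v) (d, w) (d, w) - η * ‖w‖ ^ 2 - q := by
      have : 0 < (α - β) * ‖d‖ ^ 2 := mul_pos (sub_pos.2 hβ) (pow_pos (norm_pos_iff.2 hd) 2)
      linarith
    simpa using eventually_lt_of_deriv_deriv_pos (hderiv t v w) (hderiv2 t v w) (by simpa using h0)
      hpos
  obtain ⟨t, ht, v, hv⟩ : ∃ t ∈ Set.Icc (0 : ℝ) 1, ∃ v,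
      ∀ s ∈ Set.Icc (0 : ℝ) 1, ∀ u, K (s, u) ≤ K (t, v) := by
    have hf' : Continuous (fderiv ℝ L) := hL.continuous_fderiv (by norm_num)
    obtain ⟨a, ha⟩ := isCompact_Icc.exists_bound_of_continuousOn (s := Set.Icc (0 : ℝ) 1)
      (f := fun t : ℝ => L (x₀ + t • d, y) - p * t - q / 2 * t ^ 2)
      (Continuous.continuousOn (by fun_prop))
    obtain ⟨A, hA⟩ := isCompact_Icc.exists_bound_of_continuousOn (s := Set.Icc (0 : ℝ) 1)
      (f := fun t : ℝ => fderiv ℝ L (x₀ + t • d, y)) (Continuous.continuousOn (by fun_prop))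
    have h0 : (0 : ℝ) ∈ Set.Icc (0 : ℝ) 1 := Set.left_mem_Icc.2 zero_le_one
    refine exists_forall_le_of_quadratic_bound hKc ((norm_nonneg _).trans (ha 0 h0))
      (A := A) (κ := (η - ρ) / 2) (by linarith) y fun s hs u => ?_
    have h1 := le_quadratic_of_hessian_le hL (x₀ + s • d, y) (0, u - y) (fun _ => hconc _ _)
    simp only [Prod.mk_add_mk, add_zero, add_sub_cancel] at h1
    have h2 : fderiv ℝ L (x₀ + s • d, y) (0, u - y) ≤ A * ‖u - y‖ := by
      refine (le_abs_self _).trans (((fderiv ℝ L _).le_opNorm _).trans ?_)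
      have : ‖((0 : E), u - y)‖ = ‖u - y‖ := by simp [Prod.norm_def]
      rw [this]
      exact mul_le_mul_of_nonneg_right (hA s hs) (norm_nonneg _)
    have h3 := (le_abs_self _).trans (ha s hs)
    simp only [K]
    linarith
  have hK0 : K (0, y₀) < K (t, v) := by
    obtain ⟨w, hw⟩ := hinc 0 y₀
    have hcrit := fderiv_eq_of_prox_max (f := fun v => L (x₀, v))
      (by fun_prop) hmax w
    have hsplit : fderiv ℝ L (x₀, y₀) (d, w) = p + fderiv ℝ L (x₀, y₀) (0, w) := by
      rw [hp, ← map_add]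
      simp
    have hev := hw (by simp [hsplit, ← fderiv_partial_right hdiff, hcrit])
    obtain ⟨s, hs, hs'⟩ := (hev.and (Ioo_mem_nhdsGT zero_lt_one)).exists
    exact hs.trans_le (hv _ ⟨by linarith [hs'.1], by linarith [hs'.2]⟩ _)
  have ht0 : t ≠ 0 := by
    rintro rfl
    have := hmax v
    simp [K] at hK0
    linarith
  have ht1 : t ≠ 1 := by
    rintro rfl
    have := hcon v
    simp [K] at hK0
    linarith
  obtain ⟨w, hw⟩ := hinc t v
  have hnhds : ∀ᶠ s in 𝓝 (0 : ℝ), t + s ∈ Set.Icc (0 : ℝ) 1 := by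
    have hc : ContinuousAt (fun s : ℝ => t + s) 0 := by fun_prop
    refine hc.eventually_mem ?_
    rw [add_zero]
    exact Icc_mem_nhds (lt_of_le_of_ne ht.1 ht0.symm) (lt_of_le_of_ne ht.2 ht1)
  have hloc : IsLocalMax (fun s : ℝ => K (t + s, v + s • w)) 0 := by
    filter_upwards [hnhds] with s hs
    simpa using hv _ hs _
  have h0 := hloc.hasDerivAt_eq_zero (hderiv t v w 0)
  obtain ⟨s, hs, hs'⟩ :=
    ((hw (by simpa using h0)).and (nhdsWithin_le_nhds hnhds)).exists
  exact absurd (hv _ hs' (v + s • w)) (not_le.2 hs)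

end SaddleCore

theorem inner_fderiv_of_inner_eq {G H : Type*} [NormedAddCommGroup G] [NormedSpace ℝ G]
    [NormedAddCommGroup H] [NormedSpace ℝ H] {k : ℕ} {L : H → ℝ} (hL : ContDiff ℝ 2 L)
    {g : G → Eu k} {ι : G → H} {J : G →L[ℝ] H} (hι : ∀ x, HasFDerivAt ι J x) {Ξ : Eu k → H}
    (hg : ∀ x u, ⟪g x, u⟫ = fderiv ℝ L (ι x) (Ξ u)) (x v : G) (u : Eu k) :
    ⟪fderiv ℝ g x v, u⟫ = fderiv ℝ (fderiv ℝ L) (ι x) (J v) (Ξ u) := by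
  have hL' : Differentiable ℝ (fderiv ℝ L) :=
    (hL.fderiv_right (m := 1) (by norm_num)).differentiable (by norm_num)
  have hd : ∀ u, HasFDerivAt (fun x => ⟪g x, u⟫)
      (((fderiv ℝ (fderiv ℝ L) (ι x)).comp J).flip (Ξ u)) x := by
    intro u
    have h1 := ((hL' (ι x)).hasFDerivAt.comp x (hι x)).clm_apply (hasFDerivAt_const (Ξ u) x)
    refine (h1.congr_of_eventuallyEq (.of_forall fun x => hg x u)).congr_fderiv ?_
    ext w
    simp
  have hgd : DifferentiableAt ℝ g x := by
    refine differentiableAt_euclidean.2 fun i => ?_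
    have := (hd (EuclideanSpace.single i 1)).differentiableAt
    simpa [EuclideanSpace.inner_single_right] using this
  have := (hgd.hasFDerivAt.inner ℝ (hasFDerivAt_const u x)).unique (hd u)
  simpa using congrArg (fun T => T v) this

section Hessian

variable {n m : ℕ} {L : Eu n × Eu m → ℝ}

theorem inner_Hxx (hL : ContDiff ℝ 2 L) (z : Eu n × Eu m) (v u : Eu n) :
    ⟪Hxx L z v, u⟫ = fderiv ℝ (fderiv ℝ L) z (v, 0) (u, 0) :=
  inner_fderiv_of_inner_eq hL (ι := fun x => (x, z.2)) (Ξ := fun u => (u, 0))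
    (fun x => hasFDerivAt_prodMk_left x z.2) (fun x u => by
      rw [inner_gradient_left, fderiv_partial_left (hL.differentiable (by norm_num))]) z.1 v u

theorem inner_Hxy (hL : ContDiff ℝ 2 L) (z : Eu n × Eu m) (w : Eu m) (u : Eu n) :
    ⟪Hxy L z w, u⟫ = fderiv ℝ (fderiv ℝ L) z (0, w) (u, 0) :=
  inner_fderiv_of_inner_eq hL (ι := fun y => (z.1, y)) (Ξ := fun u => (u, 0))
    (fun y => hasFDerivAt_prodMk_right z.1 y) (fun y u => by
      rw [inner_gradient_left, fderiv_partial_left (hL.differentiable (by norm_num))]) z.2 w u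

theorem inner_Hyx (hL : ContDiff ℝ 2 L) (z : Eu n × Eu m) (v : Eu n) (w : Eu m) :
    ⟪Hyx L z v, w⟫ = fderiv ℝ (fderiv ℝ L) z (v, 0) (0, w) :=
  inner_fderiv_of_inner_eq hL (ι := fun x => (x, z.2)) (Ξ := fun w => (0, w))
    (fun x => hasFDerivAt_prodMk_left x z.2) (fun x w => by
      rw [inner_gradient_left, fderiv_partial_right (hL.differentiable (by norm_num))]) z.1 v w

theorem inner_Hyy (hL : ContDiff ℝ 2 L) (z : Eu n × Eu m) (w w' : Eu m) :
    ⟪Hyy L z w, w'⟫ = fderiv ℝ (fderiv ℝ L) z (0, w) (0, w') :=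
  inner_fderiv_of_inner_eq hL (ι := fun y => (z.1, y)) (Ξ := fun w => (0, w))
    (fun y => hasFDerivAt_prodMk_right z.1 y) (fun y w => by
      rw [inner_gradient_left, fderiv_partial_right (hL.differentiable (by norm_num))]) z.2 w w'

theorem WeaklyConvexConcave.hessian_right_le {ρ : ℝ} (hweak : WeaklyConvexConcave ρ L)
    (hL : ContDiff ℝ 2 L) (z : Eu n × Eu m) (w : Eu m) :
    fderiv ℝ (fderiv ℝ L) z (0, w) (0, w) ≤ ρ * ‖w‖ ^ 2 :=
  inner_Hyy hL z w w ▸ (hweak z).2 w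

theorem apply_ringInverse_of_inner_pos {k : ℕ} {T : Eu k →L[ℝ] Eu k}
    (hT : ∀ w, w ≠ 0 → 0 < ⟪T w, w⟫) (u : Eu k) : T (Ring.inverse T u) = u := by
  have hinj : Function.Injective T := by
    refine (injective_iff_map_eq_zero T).2 fun w hw => ?_
    by_contra h
    simpa [hw] using hT w h
  have hunit : IsUnit T := ContinuousLinearMap.isUnit_iff_bijective.2
    ⟨hinj, LinearMap.surjective_of_injective (f := (T : Eu k →ₗ[ℝ] Eu k)) hinj⟩
  exact congrArg (fun S : Eu k →L[ℝ] Eu k => S u) (Ring.mul_inverse_cancel T hunit)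

theorem IntDomX.exists_direction {ρ η α : ℝ} (hdom : IntDomX η α L) (hL : ContDiff ℝ 2 L)
    (hweak : WeaklyConvexConcave ρ L) (hρη : ρ < η) (z : Eu n × Eu m) (d : Eu n) :
    ∃ w : Eu m, α * ‖d‖ ^ 2 ≤ fderiv ℝ (fderiv ℝ L) z (d, w) (d, w) - η * ‖w‖ ^ 2 := by
  set T := η • (1 : Eu m →L[ℝ] Eu m) - Hyy L z with hTdef
  have hTinner : ∀ w, ⟪T w, w⟫ = η * ‖w‖ ^ 2 - ⟪Hyy L z w, w⟫ := fun w => by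
    simp [hTdef, inner_sub_left, real_inner_smul_left]
  have hTpos : ∀ w, w ≠ 0 → 0 < ⟪T w, w⟫ := fun w hw => by
    have h1 := (hweak z).2 w
    have h2 : 0 < (η - ρ) * ‖w‖ ^ 2 := mul_pos (sub_pos.2 hρη) (pow_pos (norm_pos_iff.2 hw) 2)
    rw [hTinner]
    linarith
  set w := Ring.inverse T (Hyx L z d) with hw
  refine ⟨w, (hdom z d).trans_eq ?_⟩
  have hTw : T w = Hyx L z d := apply_ringInverse_of_inner_pos hTpos _
  have h1 := hTinner w
  rw [hTw, inner_Hyx hL, inner_Hyy hL] at h1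
  have hsymm : fderiv ℝ (fderiv ℝ L) z (0, w) (d, 0) = fderiv ℝ (fderiv ℝ L) z (d, 0) (0, w) :=
    (hL.contDiffAt.isSymmSndFDerivAt (by simp)) _ _
  have hsplit : (d, w) = (d, (0 : Eu m)) + ((0 : Eu n), w) := by simp
  rw [inner_add_left, inner_Hxx hL, inner_Hxy hL, hsplit]
  simp only [map_add, add_apply]
  rw [hsymm]
  linarith

theorem bddBelow_prox_max {ρ η : ℝ} (hL : ContDiff ℝ 2 L) (hweak : WeaklyConvexConcave ρ L)
    (hρη : ρ < η) (x : Eu n) (y : Eu m) :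
    BddBelow (Set.range fun v => -L (x, v) + η / 2 * ‖v - y‖ ^ 2) := by
  set A := ‖fderiv ℝ L (x, y)‖ with hA
  refine ⟨-L (x, y) - A ^ 2 / (2 * (η - ρ)), ?_⟩
  rintro _ ⟨v, rfl⟩
  have h1 := le_quadratic_of_hessian_le hL (x, y) (0, v - y) (fun _ => hweak.hessian_right_le hL _ _)
  simp only [Prod.mk_add_mk, add_zero, add_sub_cancel] at h1
  have h2 : fderiv ℝ L (x, y) (0, v - y) ≤ A * ‖v - y‖ := by
    refine (le_abs_self _).trans (((fderiv ℝ L _).le_opNorm _).trans_eq ?_)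
    simp [Prod.norm_def, hA]
  have hpos : 0 < η - ρ := sub_pos.2 hρη
  have h3 : A * ‖v - y‖ ≤ A ^ 2 / (2 * (η - ρ)) + (η - ρ) / 2 * ‖v - y‖ ^ 2 := by
    have : 0 ≤ (A - (η - ρ) * ‖v - y‖) ^ 2 / (2 * (η - ρ)) := by positivity
    have h4 : (A - (η - ρ) * ‖v - y‖) ^ 2 / (2 * (η - ρ)) =
        A ^ 2 / (2 * (η - ρ)) + (η - ρ) / 2 * ‖v - y‖ ^ 2 - A * ‖v - y‖ := by
      field_simp
      ring
    linarith
  simp only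
  linarith

theorem IsProxPoint.max_right {η : ℝ} {z w : Eu n × Eu m} (h : IsProxPoint η L z w) (v : Eu m) :
    L (w.1, v) - η / 2 * ‖v - z.2‖ ^ 2 ≤ L (w.1, w.2) - η / 2 * ‖w.2 - z.2‖ ^ 2 := by
  have := h.1 v
  simp only [proxObj] at this
  linarith

theorem IsProxPoint.fderiv_right {η : ℝ} {z w : Eu n × Eu m} (h : IsProxPoint η L z w)
    (hL : Differentiable ℝ L) (v : Eu m) :
    fderiv ℝ L w (0, v) = η * ⟪w.2 - z.2, v⟫ := by
  rw [← fderiv_eq_of_prox_max (f := fun v => L (w.1, v)) (by fun_prop) h.max_right v,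
    fderiv_partial_right hL]

theorem IsProxPoint.fderiv_left {η : ℝ} {z w : Eu n × Eu m} (h : IsProxPoint η L z w)
    (hL : Differentiable ℝ L) (v : Eu n) :
    fderiv ℝ L w (v, 0) = -(η * ⟪w.1 - z.1, v⟫) := by
  have hmax : ∀ u, -L (u, w.2) - η / 2 * ‖u - z.1‖ ^ 2 ≤
      -L (w.1, w.2) - η / 2 * ‖w.1 - z.1‖ ^ 2 := fun u => by
    have := h.2 u
    simp only [proxObj] at this
    linarith
  rw [← fderiv_eq_of_prox_max (f := fun u => -L (u, w.2)) (by fun_prop) hmax v, fderiv_fun_neg,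
    neg_apply, neg_neg, fderiv_partial_left hL]

/-- At the base point of a proximal step, the maximal value in `y` exceeds its value along the step
by a quadratic term, since interaction dominance makes this maximal value strongly convex in `x`. -/
theorem IsProxPoint.le_neg_moreau {ρ η α : ℝ} {z w : Eu n × Eu m} (h : IsProxPoint η L z w)
    (hL : ContDiff ℝ 2 L) (hweak : WeaklyConvexConcave ρ L) (hρη : ρ < η)
    (hdom : IntDomX η α L) :
    L w - η / 2 * ‖w.2 - z.2‖ ^ 2 + (η + α / 2) * ‖w.1 - z.1‖ ^ 2 ≤
      -moreau η (fun v => -L (z.1, v)) z.2 := by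
  have hle : ∀ v, L (z.1, v) - η / 2 * ‖v - z.2‖ ^ 2 ≤ -moreau η (fun v => -L (z.1, v)) z.2 :=
    fun v => by
      have := ciInf_le (bddBelow_prox_max hL hweak hρη z.1 z.2) v
      simp only [moreau]
      linarith
  rcases eq_or_ne w.1 z.1 with hd | hd
  · have hw : L (z.1, w.2) = L w := by rw [← hd]
    have := hle w.2
    simpa [hd, hw] using this
  refine le_of_forall_pos_lt_add fun ε hε => ?_
  have hnorm : 0 < ‖w.1 - z.1‖ ^ 2 := pow_pos (norm_pos_iff.2 (sub_ne_zero.2 hd)) 2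
  obtain ⟨v, hv⟩ := exists_lt_prox_max hL hρη (hweak.hessian_right_le hL)
    (hdom.exists_direction hL hweak hρη) h.max_right (d := z.1 - w.1) (sub_ne_zero.2 hd.symm)
    (β := α - 2 * ε / ‖w.1 - z.1‖ ^ 2) (sub_lt_self _ (by positivity))
  have hderiv : fderiv ℝ L (w.1, w.2) (z.1 - w.1, 0) = η * ‖w.1 - z.1‖ ^ 2 := by
    rw [h.fderiv_left (hL.differentiable (by norm_num)), ← neg_sub w.1 z.1, inner_neg_right,
      real_inner_self_eq_norm_sq]
    ring
  have hε' : (α - 2 * ε / ‖w.1 - z.1‖ ^ 2) / 2 * ‖w.1 - z.1‖ ^ 2 =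
      α / 2 * ‖w.1 - z.1‖ ^ 2 - ε := by
    rw [div_mul_eq_mul_div, sub_mul, div_mul_cancel₀ _ hnorm.ne']
    ring
  rw [hderiv, norm_sub_rev z.1 w.1, hε', add_sub_cancel] at hv
  have := hle v
  linarith

/-- At the end point of a proximal step, weak concavity bounds the maximal value in `y`. -/
theorem IsProxPoint.neg_moreau_le {ρ η : ℝ} {z w : Eu n × Eu m} (h : IsProxPoint η L z w)
    (hL : ContDiff ℝ 2 L) (hweak : WeaklyConvexConcave ρ L) (hρη : ρ < η) :
    -moreau η (fun v => -L (w.1, v)) w.2 ≤ L w + η ^ 2 / (2 * (η - ρ)) * ‖w.2 - z.2‖ ^ 2 := by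
  rw [neg_le]
  refine le_ciInf fun v => ?_
  have h1 := le_quadratic_of_hessian_le hL (w.1, w.2) (0, v - w.2)
    (fun _ => hweak.hessian_right_le hL _ _)
  rw [h.fderiv_right (hL.differentiable (by norm_num))] at h1
  simp only [Prod.mk_add_mk, add_zero, add_sub_cancel] at h1
  have hpos : 0 < η - ρ := sub_pos.2 hρη
  have h2 : 0 ≤ ‖η • (w.2 - z.2) - (η - ρ) • (v - w.2)‖ ^ 2 / (2 * (η - ρ)) := by positivity
  have h3 : ‖η • (w.2 - z.2) - (η - ρ) • (v - w.2)‖ ^ 2 / (2 * (η - ρ)) =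
      η ^ 2 / (2 * (η - ρ)) * ‖w.2 - z.2‖ ^ 2 - η * ⟪w.2 - z.2, v - w.2⟫
        + (η - ρ) / 2 * ‖v - w.2‖ ^ 2 := by
    rw [norm_sub_sq_real, norm_smul, norm_smul, real_inner_smul_left, real_inner_smul_right,
      mul_pow, mul_pow, Real.norm_eq_abs, Real.norm_eq_abs, sq_abs, sq_abs]
    field_simp
  linarith

end Hessian

section NegSwap

variable {n m : ℕ} {L : Eu n × Eu m → ℝ}

/-- The saddle function with the roles of the minimizing and maximizing players exchanged. -/
def negSwap (L : Eu n × Eu m → ℝ) (z : Eu m × Eu n) : ℝ := -L z.swap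

theorem gradient_neg_apply {k : ℕ} (f : Eu k → ℝ) (x : Eu k) :
    gradient (fun u => -f u) x = -gradient f x := by
  simp [gradient, fderiv_fun_neg]

theorem Hxx_negSwap (z : Eu m × Eu n) : Hxx (negSwap L) z = -Hyy L z.swap := by
  simp [Hxx, Hyy, negSwap, gradient_neg_apply, fderiv_fun_neg]

theorem Hxy_negSwap (z : Eu m × Eu n) : Hxy (negSwap L) z = -Hyx L z.swap := by
  simp [Hxy, Hyx, negSwap, gradient_neg_apply, fderiv_fun_neg]

theorem Hyx_negSwap (z : Eu m × Eu n) : Hyx (negSwap L) z = -Hxy L z.swap := by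
  simp [Hxy, Hyx, negSwap, gradient_neg_apply, fderiv_fun_neg]

theorem Hyy_negSwap (z : Eu m × Eu n) : Hyy (negSwap L) z = -Hxx L z.swap := by
  simp [Hxx, Hyy, negSwap, gradient_neg_apply, fderiv_fun_neg]

theorem contDiff_negSwap (hL : ContDiff ℝ 2 L) : ContDiff ℝ 2 (negSwap L) :=
  (hL.comp (contDiff_snd.prodMk contDiff_fst)).neg

theorem WeaklyConvexConcave.negSwap {ρ : ℝ} (hweak : WeaklyConvexConcave ρ L) :
    WeaklyConvexConcave ρ (negSwap L) := by
  refine fun z => ⟨fun v => ?_, fun w => ?_⟩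
  · have := (hweak z.swap).2 v
    simp only [Hxx_negSwap, neg_apply, inner_neg_left]
    linarith
  · have := (hweak z.swap).1 w
    simp only [Hyy_negSwap, neg_apply, inner_neg_left]
    linarith

theorem IntDomY.negSwap {η α : ℝ} (hdom : IntDomY η α L) : IntDomX η α (negSwap L) := by
  intro z v
  simpa [Hxx_negSwap, Hxy_negSwap, Hyx_negSwap, Hyy_negSwap] using hdom z.swap v

theorem IsProxPoint.negSwap {η : ℝ} {z w : Eu n × Eu m} (h : IsProxPoint η L z w) :
    IsProxPoint η (negSwap L) z.swap w.swap := by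
  refine ⟨fun v => ?_, fun u => ?_⟩
  · have := h.2 v
    simp only [proxObj, _root_.negSwap, Prod.swap, Prod.mk.eta] at this ⊢
    linarith
  · have := h.1 u
    simp only [proxObj, _root_.negSwap, Prod.swap, Prod.mk.eta] at this ⊢
    linarith

end NegSwap

/-- descent-type recurrence for the Lyapunov function along a
proximal step, under α-interaction dominance in both variables. -/
theorem statement13 {n m : ℕ}
    (L : Eu n × Eu m → ℝ) (ρ η α : ℝ)
    (hL : ContDiff ℝ 2 L)
    (hweak : WeaklyConvexConcave ρ L)
    (hη : max ρ 0 < η)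
    (hdomx : IntDomX η α L) (hdomy : IntDomY η α L)
    (prox : Eu n × Eu m → Eu n × Eu m)
    (hprox : ∀ z, IsProxPoint η L z (prox z))
    (hprox_uniq : ∀ z w, IsProxPoint η L z w → w = prox z) :
    ∀ z : Eu n × Eu m,
      lyap η L (prox z) ≤ lyap η L z -
        1 / 2 * (α - η * ρ / (η - ρ)) *
          (‖(prox z).1 - z.1‖ ^ 2 + ‖(prox z).2 - z.2‖ ^ 2) := by
  intro z
  have hρη : ρ < η := (le_max_left _ _).trans_lt hη
  have h := hprox z
  have hlow := h.le_neg_moreau hL hweak hρη hdomx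
  have hlow' := h.negSwap.le_neg_moreau (contDiff_negSwap hL) hweak.negSwap hρη hdomy.negSwap
  have hup := h.neg_moreau_le hL hweak hρη
  have hup' := h.negSwap.neg_moreau_le (contDiff_negSwap hL) hweak.negSwap hρη
  simp only [negSwap, neg_neg, Prod.swap, Prod.mk.eta] at hlow' hup'
  have hcoef : η ^ 2 / (2 * (η - ρ)) = 1 / 2 * (η + η * ρ / (η - ρ)) := by
    have : η - ρ ≠ 0 := (sub_pos.2 hρη).ne'
    field_simp
    ring
  rw [hcoef] at hup hup'
  simp only [lyap]
  linarith

end
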